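/- Let S₁,…,S_l be ordered set partitions of pairwise disjoint nonempty subsets J₁,…,J_l of {1,…,n} with J₁ ∪ ⋯ ∪ J_l = {1,…,n}, and let m be the total number of blocks of S₁,…,S_l. Then the indicator function of the Minkowski sum of the plates [S₁] + ⋯ + [S_l] equals ∑_T (−1)^{m−len(T)} [[T]], where T ranges over all shuffle-lumpings of S₁,…,S_l and [[T]] is the indicator of the plate of the ordered set partition T of {1,…,n}. -/

import Mathlib

open scoped Pointwise Classical

namespace PlatesPaper

/-- The union of a list of finite sets. -/
def lUnion {n : ℕ} (L : List (Finset (Fin n))) : Finset (Fin n) :=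
  L.foldr (· ∪ ·) ∅

/-- `L` is an ordered set partition of `J`: a list of pairwise disjoint nonempty
finite sets whose union is `J`. -/
def IsOSP {n : ℕ} (J : Finset (Fin n)) (L : List (Finset (Fin n))) : Prop :=
  (∀ B ∈ L, B.Nonempty) ∧ L.Pairwise Disjoint ∧ lUnion L = J

/-- The plate of an ordered set partition `L` (of a subset `J = lUnion L` of `{1,…,n}`):
the set of `x ∈ V₀ⁿ` vanishing outside `J`, with `x_J = 0`, and such that the partial
sums over the unions of the first `i` blocks are nonnegative for `i = 1,…,len(L)−1`.
(For an ordered set partition of the whole of `{1,…,n}` the first two conditions are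
equivalent to `x ∈ V₀ⁿ`.) -/
def plate {n : ℕ} (L : List (Finset (Fin n))) : Set (Fin n → ℝ) :=
  {x | (∑ i, x i = 0) ∧ (∀ j, j ∉ lUnion L → x j = 0) ∧ (∑ j ∈ lUnion L, x j = 0) ∧
    ∀ i : ℕ, 0 < i → i < L.length → 0 ≤ ∑ j ∈ lUnion (L.take i), x j}

/-- `ℚ`-valued indicator function of a set of points of `ℝⁿ`. -/
noncomputable def ind {n : ℕ} (S : Set (Fin n → ℝ)) : (Fin n → ℝ) → ℚ :=
  fun x => if x ∈ S then 1 else 0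

/-- The index of the block of `L` containing the element `a`. -/
def blockIdx {n : ℕ} (L : List (Finset (Fin n))) (a : Fin n) : ℕ :=
  L.findIdx fun B => decide (a ∈ B)

/-- The index of the block of `L` containing the set `B`. -/
def subIdx {n : ℕ} (L : List (Finset (Fin n))) (B : Finset (Fin n)) : ℕ :=
  L.findIdx fun C => decide (B ⊆ C)

/-- `B` is contained in one of the blocks of `L`. -/
def memBlock {n : ℕ} (L : List (Finset (Fin n))) (B : Finset (Fin n)) : Prop :=
  ∃ j < L.length, B ⊆ L.getD j ∅

/-- `T` is a shuffle-lumping of the ordered set partitions in the list `Ls`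
(of pairwise disjoint subsets whose union is `{1,…,n}`): `T` is an ordered set
partition of `{1,…,n}`, each block of each member of `Ls` is contained in a block of `T`
(equivalently, each block of `T` is a union of such blocks), and for each member `M` of
`Ls` the blocks of `M` land in strictly increasing blocks of `T`. -/
def IsShuffleLumping {n : ℕ} (Ls : List (List (Finset (Fin n))))
    (T : List (Finset (Fin n))) : Prop :=
  IsOSP Finset.univ T ∧
  (∀ M ∈ Ls, ∀ B ∈ M, ∃ j < T.length, B ⊆ T.getD j ∅) ∧
  (∀ M ∈ Ls, ∀ p q : ℕ, p < q → q < M.length →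
    subIdx T (M.getD p ∅) < subIdx T (M.getD q ∅))

/-- All suffix sums of `T` are nonpositive. -/
def good {n : ℕ} (x : Fin n → ℝ) : List (Finset (Fin n)) → Prop
  | [] => True
  | B :: T => (∑ j ∈ lUnion (B :: T), x j ≤ 0) ∧ good x T

noncomputable def gi {n : ℕ} (x : Fin n → ℝ) (T : List (Finset (Fin n))) : ℚ :=
  if good x T then 1 else 0

structure Valid {n : ℕ} {ι : Type} (M : ι → List (Finset (Fin n))) : Prop where
  ne : ∀ i, ∀ B ∈ M i, B.Nonempty
  pd : ∀ i, (M i).Pairwise Disjoint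
  cd : ∀ i j, i ≠ j → Disjoint (lUnion (M i)) (lUnion (M j))

noncomputable def tl {n : ℕ} {ι : Type} (A : Finset ι) (M : ι → List (Finset (Fin n))) (i : ι) :
    List (Finset (Fin n)) := if i ∈ A then (M i).tail else M i

def tot {n : ℕ} {ι : Type} [Fintype ι] (M : ι → List (Finset (Fin n))) : ℕ :=
  ∑ i, (M i).length

def JJ {n : ℕ} {ι : Type} [Fintype ι] (M : ι → List (Finset (Fin n))) : Finset (Fin n) :=
  Finset.univ.biUnion fun i => lUnion (M i)

def hd {n : ℕ} {ι : Type} (A : Finset ι) (M : ι → List (Finset (Fin n))) : Finset (Fin n) :=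
  A.biUnion fun i => (M i).headD ∅

structure GSL {n : ℕ} {ι : Type} [Fintype ι] (M : ι → List (Finset (Fin n)))
    (T : List (Finset (Fin n))) : Prop where
  ne : ∀ B ∈ T, B.Nonempty
  pd : T.Pairwise Disjoint
  un : lUnion T = JJ M
  bl : ∀ i, ∀ B ∈ M i, ∃ C ∈ T, B ⊆ C
  mo : ∀ i, (M i).Pairwise fun B B' => subIdx T B < subIdx T B'

theorem mem_lUnion {n : ℕ} (L : List (Finset (Fin n))) (a : Fin n) :
    a ∈ lUnion L ↔ ∃ B ∈ L, a ∈ B := by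
  induction L with
  | nil => simp [lUnion]
  | cons B L ih =>
    have : lUnion (B :: L) = B ∪ lUnion L := rfl
    simp [this, ih]

theorem lUnion_cons {n : ℕ} (B : Finset (Fin n)) (L : List (Finset (Fin n))) :
    lUnion (B :: L) = B ∪ lUnion L := rfl

theorem subIdx_cons {n : ℕ} (C : Finset (Fin n)) (T : List (Finset (Fin n)))
    (B : Finset (Fin n)) :
    subIdx (C :: T) B = if B ⊆ C then 0 else subIdx T B + 1 := by
  unfold subIdx
  rw [List.findIdx_cons]
  by_cases h : B ⊆ C <;> simp [h]

theorem mem_JJ {n : ℕ} {ι : Type} [Fintype ι] (M : ι → List (Finset (Fin n))) (a : Fin n) :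
    a ∈ JJ M ↔ ∃ i, ∃ B ∈ M i, a ∈ B := by
  simp [JJ, mem_lUnion]

theorem mem_tl {n : ℕ} {ι : Type} {A : Finset ι} {M : ι → List (Finset (Fin n))} {i : ι}
    {B : Finset (Fin n)} (h : B ∈ tl A M i) : B ∈ M i := by
  unfold tl at h
  split_ifs at h
  · exact List.mem_of_mem_tail h
  · exact h

theorem tl_sublist {n : ℕ} {ι : Type} (A : Finset ι) (M : ι → List (Finset (Fin n))) (i : ι) :
    (tl A M i).Sublist (M i) := by
  unfold tl
  split_ifs
  · exact List.tail_sublist _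
  · exact List.Sublist.refl _

theorem Valid.idx {n : ℕ} {ι : Type} {M : ι → List (Finset (Fin n))} (hM : Valid M)
    {i j : ι} {B B' : Finset (Fin n)} {a : Fin n} (hB : B ∈ M i) (hB' : B' ∈ M j)
    (ha : a ∈ B) (ha' : a ∈ B') : i = j := by
  by_contra h
  exact Finset.disjoint_left.mp (hM.cd i j h) ((mem_lUnion _ _).2 ⟨B, hB, ha⟩)
    ((mem_lUnion _ _).2 ⟨B', hB', ha'⟩)

theorem Valid.tl {n : ℕ} {ι : Type} {M : ι → List (Finset (Fin n))} (hM : Valid M)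
    (A : Finset ι) : Valid (tl A M) where
  ne i B hB := hM.ne i B (mem_tl hB)
  pd i := (hM.pd i).sublist (tl_sublist A M i)
  cd i j h := by
    rw [Finset.disjoint_left]
    intro a ha ha'
    rw [mem_lUnion] at ha ha'
    obtain ⟨B, hB, ha⟩ := ha
    obtain ⟨B', hB', ha'⟩ := ha'
    exact h (hM.idx (mem_tl hB) (mem_tl hB') ha ha')

theorem pd_eq {n : ℕ} {T : List (Finset (Fin n))} (h : T.Pairwise Disjoint)
    {B C : Finset (Fin n)} (hB : B ∈ T) (hC : C ∈ T) {a : Fin n} (ha : a ∈ B) (ha' : a ∈ C) :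
    B = C := by
  by_contra hne
  have hsy : Std.Symm (Disjoint : Finset (Fin n) → Finset (Fin n) → Prop) :=
    ⟨fun _ _ h => h.symm⟩
  have := h.forall hB hC hne
  exact Finset.disjoint_left.mp this ha ha'

theorem mem_hd {n : ℕ} {ι : Type} {A : Finset ι} {M : ι → List (Finset (Fin n))} {a : Fin n} :
    a ∈ hd A M ↔ ∃ i ∈ A, ∃ B L, M i = B :: L ∧ a ∈ B := by
  simp only [hd, Finset.mem_biUnion]
  constructor
  · rintro ⟨i, hi, ha⟩
    refine ⟨i, hi, ?_⟩
    cases hm : M i with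
    | nil => simp [hm] at ha
    | cons B L => exact ⟨B, L, rfl, by simpa [hm] using ha⟩
  · rintro ⟨i, hi, B, L, h, ha⟩
    exact ⟨i, hi, by simpa [h] using ha⟩

/-- union of the tails is disjoint from the heads -/
theorem hd_disj {n : ℕ} {ι : Type} {M : ι → List (Finset (Fin n))}
    (hM : Valid M) (A : Finset ι) {a : Fin n} (ha : a ∈ hd A M) {i : ι} {B : Finset (Fin n)}
    (hB : B ∈ tl A M i) (haB : a ∈ B) : False := by
  rw [mem_hd] at ha
  obtain ⟨j, hj, B', L, hL, ha⟩ := ha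
  have hij : i = j := hM.idx (mem_tl hB) (by rw [hL]; simp) haB ha
  subst hij
  rw [tl, if_pos hj, hL, List.tail_cons] at hB
  have hp := hM.pd i
  rw [hL, List.pairwise_cons] at hp
  exact Finset.disjoint_left.mp (hp.1 B hB) ha haB

theorem mem_JJ_iff {n : ℕ} {ι : Type} [Fintype ι] (M : ι → List (Finset (Fin n)))
    (A : Finset ι) (a : Fin n) : a ∈ JJ M ↔ a ∈ hd A M ∨ a ∈ JJ (tl A M) := by
  rw [mem_JJ, mem_JJ, mem_hd]
  constructor
  · rintro ⟨i, B, hB, ha⟩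
    by_cases hi : i ∈ A
    · cases hm : M i with
      | nil => simp [hm] at hB
      | cons C L =>
        rw [hm, List.mem_cons] at hB
        rcases hB with rfl | hB
        · exact Or.inl ⟨i, hi, B, L, hm, ha⟩
        · exact Or.inr ⟨i, B, by simp [tl, hi, hm, hB], ha⟩
    · exact Or.inr ⟨i, B, by simp [tl, hi, hB], ha⟩
  · rintro (⟨i, hi, B, L, h, ha⟩ | ⟨i, B, hB, ha⟩)
    · exact ⟨i, B, by simp [h], ha⟩
    · exact ⟨i, B, mem_tl hB, ha⟩

theorem GSL.cons {n : ℕ} {ι : Type} [Fintype ι] {M : ι → List (Finset (Fin n))} (hM : Valid M)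
    {A : Finset ι} (hA : A.Nonempty) (hA' : ∀ i ∈ A, M i ≠ []) {T : List (Finset (Fin n))}
    (hT : GSL (PlatesPaper.tl A M) T) : GSL M (hd A M :: T) := by
  have hsub : ∀ i, ∀ B ∈ PlatesPaper.tl A M i, ¬ B ⊆ hd A M := by
    intro i B hB hs
    obtain ⟨a, ha⟩ := hM.ne i B (mem_tl hB)
    exact hd_disj hM A (hs ha) hB ha
  have hhd : ∀ i ∈ A, ∀ B L, M i = B :: L → B ⊆ hd A M := by
    intro i hi B L h a ha
    exact mem_hd.2 ⟨i, hi, B, L, h, ha⟩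
  refine ⟨?_, ?_, ?_, ?_, ?_⟩
  · intro B hB
    rw [List.mem_cons] at hB
    rcases hB with rfl | hB
    · obtain ⟨i, hi⟩ := hA
      cases hm : M i with
      | nil => exact absurd hm (hA' i hi)
      | cons C L =>
        obtain ⟨a, ha⟩ := hM.ne i C (by simp [hm])
        exact ⟨a, hhd i hi C L hm ha⟩
    · exact hT.ne B hB
  · rw [List.pairwise_cons]
    refine ⟨?_, hT.pd⟩
    intro C hC
    rw [Finset.disjoint_left]
    intro a ha haC
    have h1 : a ∈ lUnion T := (mem_lUnion _ _).2 ⟨C, hC, haC⟩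
    rw [hT.un, mem_JJ] at h1
    obtain ⟨i, B, hB, haB⟩ := h1
    exact hd_disj hM A ha hB haB
  · ext a
    rw [mem_JJ_iff M A, ← hT.un, lUnion_cons, Finset.mem_union]
  · intro i B hB
    by_cases hi : i ∈ A
    · cases hm : M i with
      | nil => exact absurd hm (hA' i hi)
      | cons C L =>
        rw [hm, List.mem_cons] at hB
        rcases hB with rfl | hB
        · exact ⟨_, by simp, hhd i hi B L hm⟩
        · obtain ⟨C', h1, h2⟩ := hT.bl i B (by simp [PlatesPaper.tl, hi, hm, hB])
          exact ⟨C', by simp [h1], h2⟩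
    · obtain ⟨C', h1, h2⟩ := hT.bl i B (by simp [PlatesPaper.tl, hi, hB])
      exact ⟨C', by simp [h1], h2⟩
  · intro i
    have key : (PlatesPaper.tl A M i).Pairwise fun B B' =>
        subIdx (hd A M :: T) B < subIdx (hd A M :: T) B' := by
      refine (hT.mo i).imp_of_mem ?_
      intro B B' hB hB' hlt
      rw [subIdx_cons, subIdx_cons, if_neg (hsub i B hB), if_neg (hsub i B' hB')]
      omega
    by_cases hi : i ∈ A
    · cases hm : M i with
      | nil => exact absurd hm (hA' i hi)
      | cons C L =>
        have e : PlatesPaper.tl A M i = L := by simp [PlatesPaper.tl, hi, hm]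
        rw [List.pairwise_cons]
        refine ⟨?_, by rw [e] at key; exact key⟩
        intro B hB
        rw [subIdx_cons, subIdx_cons, if_pos (hhd i hi C L hm),
          if_neg (hsub i B (by rw [e]; exact hB))]
        omega
    · have e : PlatesPaper.tl A M i = M i := by simp [PlatesPaper.tl, hi]
      rw [e] at key
      exact key

theorem GSL.uncons {n : ℕ} {ι : Type} [Fintype ι] {M : ι → List (Finset (Fin n))}
    (hM : Valid M) {C : Finset (Fin n)} {T : List (Finset (Fin n))}
    (hT : GSL M (C :: T)) : ∃ A : Finset ι, A.Nonempty ∧ (∀ i ∈ A, M i ≠ []) ∧ C = hd A M ∧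
      GSL (PlatesPaper.tl A M) T := by
  have hpd := List.pairwise_cons.1 hT.pd
  -- only heads can be contained in C
  have hhead : ∀ i B L, M i = B :: L → ∀ B' ∈ L, ¬ B' ⊆ C := by
    intro i B L h B' hB' hs
    have := hT.mo i
    rw [h, List.pairwise_cons] at this
    have := this.1 B' hB'
    rw [subIdx_cons C T B', if_pos hs] at this
    omega
  let A : Finset ι := Finset.univ.filter fun i => ∃ B L, M i = B :: L ∧ B ⊆ C
  have hAm : ∀ i, i ∈ A ↔ ∃ B L, M i = B :: L ∧ B ⊆ C := by simp [A]
  have hC : C = hd A M := by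
    ext a
    rw [mem_hd]
    constructor
    · intro ha
      have h1 : a ∈ lUnion (C :: T) := (mem_lUnion _ _).2 ⟨C, by simp, ha⟩
      rw [hT.un, mem_JJ] at h1
      obtain ⟨i, B, hB, haB⟩ := h1
      obtain ⟨C', hC', hs⟩ := hT.bl i B hB
      have : C' = C := pd_eq hT.pd hC' (by simp) (hs haB) ha
      subst this
      cases hm : M i with
      | nil => simp [hm] at hB
      | cons D L =>
        rw [hm, List.mem_cons] at hB
        rcases hB with rfl | hB
        · exact ⟨i, (hAm i).2 ⟨B, L, hm, hs⟩, B, L, hm, haB⟩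
        · exact absurd hs (hhead i D L hm B hB)
    · rintro ⟨i, hi, B, L, h, ha⟩
      obtain ⟨B', L', h', hs⟩ := (hAm i).1 hi
      rw [h] at h'
      injection h' with e1 e2
      subst e1
      exact hs ha
  have hns : ∀ i, ∀ B ∈ PlatesPaper.tl A M i, ¬ B ⊆ C := by
    intro i B hB hs
    obtain ⟨a, ha⟩ := hM.ne i B (mem_tl hB)
    exact hd_disj hM A (by rw [← hC]; exact hs ha) hB ha
  refine ⟨A, ?_, ?_, hC, ?_, ?_, ?_, ?_, ?_⟩
  · obtain ⟨a, ha⟩ := hT.ne C (by simp)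
    rw [hC, mem_hd] at ha
    obtain ⟨i, hi, _⟩ := ha
    exact ⟨i, hi⟩
  · intro i hi h
    obtain ⟨B, L, h', _⟩ := (hAm i).1 hi
    simp [h] at h'
  · intro B hB
    exact hT.ne B (by simp [hB])
  · exact hpd.2
  · ext a
    have h1 : a ∈ lUnion (C :: T) ↔ a ∈ JJ M := by rw [hT.un]
    rw [mem_JJ_iff M A, lUnion_cons, Finset.mem_union, ← hC] at h1
    constructor
    · intro ha
      rcases h1.1 (Or.inr ha) with h | h
      · obtain ⟨D, hD, haD⟩ := (mem_lUnion _ _).1 ha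
        exact absurd haD (Finset.disjoint_left.mp (hpd.1 D hD) h)
      · exact h
    · intro ha
      rcases h1.2 (Or.inr ha) with h | h
      · obtain ⟨i, B, hB, haB⟩ := (mem_JJ _ _).1 ha
        exact (hd_disj hM A (by rw [← hC]; exact h) hB haB).elim
      · exact h
  · intro i B hB
    obtain ⟨D, hD, hs⟩ := hT.bl i B (mem_tl hB)
    rw [List.mem_cons] at hD
    rcases hD with rfl | hD
    · exact absurd hs (hns i B hB)
    · exact ⟨D, hD, hs⟩
  · intro i
    refine ((hT.mo i).sublist (tl_sublist A M i)).imp_of_mem ?_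
    intro B B' hB hB' hlt
    rw [subIdx_cons, subIdx_cons, if_neg (hns i B hB), if_neg (hns i B' hB')] at hlt
    omega

theorem hd_inj {n : ℕ} {ι : Type} {M : ι → List (Finset (Fin n))} (hM : Valid M)
    {A A' : Finset ι} (hA : ∀ i ∈ A, M i ≠ []) (h : hd A M = hd A' M) : A ⊆ A' := by
  intro i hi
  cases hm : M i with
  | nil => exact absurd hm (hA i hi)
  | cons B L =>
    obtain ⟨a, ha⟩ := hM.ne i B (by simp [hm])
    have h1 : a ∈ hd A' M := by rw [← h]; exact mem_hd.2 ⟨i, hi, B, L, hm, ha⟩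
    obtain ⟨j, hj, B', L', h', ha'⟩ := mem_hd.1 h1
    have : i = j := hM.idx (B := B) (B' := B') (by simp [hm]) (by simp [h']) ha ha'
    rw [this]; exact hj

theorem tot_tl {n : ℕ} {ι : Type} [Fintype ι] {M : ι → List (Finset (Fin n))}
    {A : Finset ι} (hA : ∀ i ∈ A, M i ≠ []) : tot M = tot (tl A M) + A.card := by
  have : A.card = ∑ i, if i ∈ A then 1 else 0 := by simp
  rw [this, tot, tot, ← Finset.sum_add_distrib]
  refine Finset.sum_congr rfl fun i _ => ?_
  by_cases hi : i ∈ A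
  · have := List.length_pos_iff.2 (hA i hi)
    simp [tl, hi]; omega
  · simp [tl, hi]

/-- support -/
noncomputable def supp {n : ℕ} {ι : Type} [Fintype ι] (M : ι → List (Finset (Fin n))) :
    Finset ι := Finset.univ.filter fun i => M i ≠ []

noncomputable def As {n : ℕ} {ι : Type} [Fintype ι] (M : ι → List (Finset (Fin n))) :
    Finset (Finset ι) := (supp M).powerset.erase ∅

theorem mem_As {n : ℕ} {ι : Type} [Fintype ι] {M : ι → List (Finset (Fin n))}
    {A : Finset ι} : A ∈ As M ↔ A.Nonempty ∧ ∀ i ∈ A, M i ≠ [] := by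
  simp [As, supp, Finset.nonempty_iff_ne_empty, Finset.subset_iff]

theorem GSL_finite {n : ℕ} {ι : Type} [Fintype ι] (M : ι → List (Finset (Fin n))) :
    {T | GSL M T}.Finite := by
  have : {T : List (Finset (Fin n)) | T.Nodup}.Finite := by
    exact Set.finite_coe_iff.1 (Finite.of_fintype {T : List (Finset (Fin n)) // T.Nodup})
  refine this.subset fun T hT => ?_
  refine List.Pairwise.imp_of_mem (R := Disjoint) ?_ hT.pd
  intro B B' hB hB' hd he
  subst he
  have := hT.ne B hB
  rw [disjoint_self] at hd
  simp [hd] at this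

theorem GSL_len {n : ℕ} {ι : Type} [Fintype ι] (T : List (Finset (Fin n))) :
    ∀ {M : ι → List (Finset (Fin n))}, Valid M → GSL M T → T.length ≤ tot M := by
  induction T with
  | nil => intro M _ _; simp
  | cons C T ih =>
    intro M hM hT
    obtain ⟨A, hA, hA', -, h⟩ := hT.uncons hM
    have := ih (hM.tl A) h
    have h2 := tot_tl hA'
    have := hA.card_pos
    simp; omega

noncomputable def FF {n : ℕ} {ι : Type} [Fintype ι] (x : Fin n → ℝ)
    (M : ι → List (Finset (Fin n))) : ℚ :=
  ∑ᶠ T ∈ {T | GSL M T}, (-1 : ℚ) ^ (tot M + T.length) * gi x T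

theorem GSL_set {n : ℕ} {ι : Type} [Fintype ι] {M : ι → List (Finset (Fin n))} (hM : Valid M)
    (hs : (supp M).Nonempty) :
    {T | GSL M T} = ⋃ A ∈ (↑(As M) : Set (Finset ι)),
      (fun T => hd A M :: T) '' {T | GSL (tl A M) T} := by
  ext T
  simp only [Set.mem_setOf_eq, Set.mem_iUnion, Set.mem_image, Finset.mem_coe, mem_As]
  constructor
  · intro hT
    cases T with
    | nil =>
      exfalso
      obtain ⟨i, hi⟩ := hs
      simp only [supp, Finset.mem_filter, Finset.mem_univ, true_and] at hi
      obtain ⟨B, hB⟩ := List.exists_mem_of_ne_nil _ hi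
      obtain ⟨C, hC, _⟩ := hT.bl i B hB
      simp at hC
    | cons C T =>
      obtain ⟨A, hA, hA', h, h'⟩ := hT.uncons hM
      exact ⟨A, ⟨hA, hA'⟩, T, h', by rw [h]⟩
  · rintro ⟨A, ⟨hA, hA'⟩, T, h', rfl⟩
    exact h'.cons hM hA hA'

theorem gi_cons {n : ℕ} (x : Fin n → ℝ) (B : Finset (Fin n)) (T : List (Finset (Fin n))) :
    gi x (B :: T) = (if ∑ j ∈ lUnion (B :: T), x j ≤ 0 then 1 else 0) * gi x T := by
  unfold gi
  simp only [good]
  by_cases h1 : ∑ j ∈ lUnion (B :: T), x j ≤ 0 <;> by_cases h2 : good x T <;> simp [h1, h2]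

theorem FF_rec {n : ℕ} {ι : Type} [Fintype ι] (x : Fin n → ℝ)
    {M : ι → List (Finset (Fin n))} (hM : Valid M) (hs : (supp M).Nonempty) :
    FF x M = (if ∑ j ∈ JJ M, x j ≤ 0 then 1 else 0) *
      ∑ A ∈ As M, (-1 : ℚ) ^ (A.card + 1) * FF x (tl A M) := by
  unfold FF
  rw [GSL_set hM hs, finsum_mem_biUnion, finsum_mem_coe_finset, Finset.mul_sum]
  · refine Finset.sum_congr rfl fun A hA => ?_
    obtain ⟨hA1, hA2⟩ := mem_As.1 hA
    rw [finsum_mem_image (by intro a _ b _ h; simpa using h)]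
    rw [← mul_assoc, mul_finsum_mem]
    refine finsum_mem_congr rfl fun T hT => ?_
    have hT' := GSL.cons hM hA1 hA2 hT
    rw [gi_cons, hT'.un, tot_tl hA2, List.length_cons]
    ring
  · intro A hA A' hA' hne
    rw [Function.onFun, Set.disjoint_left]
    rintro _ ⟨T, _, rfl⟩ ⟨T', _, h⟩
    simp only [List.cons.injEq] at h
    exact hne (Finset.Subset.antisymm
      (hd_inj hM (mem_As.1 hA).2 h.1.symm) (hd_inj hM (mem_As.1 hA').2 h.1))
  · exact Finset.finite_toSet _
  · intro A _
    exact (GSL_finite _).image _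

theorem sum_JJ {n : ℕ} {ι : Type} [Fintype ι] (x : Fin n → ℝ)
    {M : ι → List (Finset (Fin n))} (hM : Valid M) :
    ∑ j ∈ JJ M, x j = ∑ i, ∑ j ∈ lUnion (M i), x j := by
  unfold JJ
  rw [Finset.sum_biUnion]
  intro i _ j _ h
  exact hM.cd i j h

theorem good_sum {n : ℕ} {x : Fin n → ℝ} {T : List (Finset (Fin n))} (h : good x T) :
    ∑ j ∈ lUnion T, x j ≤ 0 := by
  cases T with
  | nil => simp [lUnion]
  | cons B T => exact h.1

theorem FF_eq {n : ℕ} {ι : Type} [Fintype ι] (x : Fin n → ℝ) (m : ℕ) :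
    ∀ M : ι → List (Finset (Fin n)), Valid M → tot M = m → FF x M = ∏ i, gi x (M i) := by
  induction m using Nat.strong_induction_on with
  | _ m ih =>
  intro M hM hm
  by_cases hs : (supp M).Nonempty
  · rw [FF_rec x hM hs]
    have h1 : ∑ A ∈ As M, (-1 : ℚ) ^ (A.card + 1) * FF x (tl A M) =
        ∑ A ∈ As M, (-1 : ℚ) ^ (A.card + 1) * ∏ i, gi x (tl A M i) := by
      refine Finset.sum_congr rfl fun A hA => ?_
      obtain ⟨hA1, hA2⟩ := mem_As.1 hA
      have h2 := tot_tl hA2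
      have := hA1.card_pos
      rw [ih (tot (tl A M)) (by omega) _ (hM.tl A) rfl]
    have h0 : ∀ i, i ∉ supp M → M i = [] := by
      intro i hi
      simpa [supp] using hi
    have hprod : ∀ A ⊆ supp M, ∏ i, gi x (tl A M i) =
        (∏ i ∈ A, gi x (M i).tail) * ∏ i ∈ supp M \ A, gi x (M i) := by
      intro A hA
      have e1 : ∏ i, gi x (tl A M i) = ∏ i ∈ supp M, gi x (tl A M i) := by
        symm
        refine Finset.prod_subset (Finset.subset_univ _) fun i _ hi => ?_
        have : i ∉ A := fun h => hi (hA h)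
        simp [tl, this, h0 i hi, gi, good]
      rw [e1, ← Finset.prod_sdiff hA, mul_comm]
      congr 1
      · refine Finset.prod_congr rfl fun i hi => ?_
        simp [tl, hi]
      · refine Finset.prod_congr rfl fun i hi => ?_
        simp [tl, (Finset.mem_sdiff.1 hi).2]
    have h3 : ∑ A ∈ (supp M).powerset, (-1 : ℚ) ^ A.card * ∏ i, gi x (tl A M i) =
        ∏ i ∈ supp M, (-gi x (M i).tail + gi x (M i)) := by
      rw [Finset.prod_add]
      refine Finset.sum_congr rfl fun A hA => ?_
      rw [hprod A (Finset.mem_powerset.1 hA), Finset.prod_neg]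
      ring
    have h4 : ∑ A ∈ As M, (-1 : ℚ) ^ (A.card + 1) * ∏ i, gi x (tl A M i) =
        ∏ i, gi x (M i) - ∏ i ∈ supp M, (-gi x (M i).tail + gi x (M i)) := by
      rw [← h3, As, ← Finset.add_sum_erase _ _ (Finset.empty_mem_powerset (supp M))]
      have : ∀ i, tl (∅ : Finset ι) M i = M i := by intro i; simp [tl]
      simp only [this, pow_succ, Finset.card_empty, pow_zero]
      simp
    rw [h1, h4]
    by_cases hy : ∑ j ∈ JJ M, x j ≤ 0
    · rw [if_pos hy, one_mul, sub_eq_self, Finset.prod_eq_zero_iff]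
      by_contra hcon
      push Not at hcon
      have hpos : ∀ i ∈ supp M, 0 < ∑ j ∈ lUnion (M i), x j := by
        intro i hi
        have := hcon i hi
        by_contra hle
        push Not at hle
        apply this
        cases hmi : M i with
        | nil => simp
        | cons B L =>
          rw [hmi] at hle
          rw [gi_cons, if_pos hle]; simp
      have : 0 < ∑ i, ∑ j ∈ lUnion (M i), x j := by
        rw [← Finset.sum_subset (Finset.subset_univ (supp M))]
        · exact Finset.sum_pos hpos hs
        · intro i _ hi
          simp [h0 i hi, lUnion]
      rw [sum_JJ x hM] at hy
      linarith
    · rw [if_neg hy, zero_mul]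
      symm
      rw [Finset.prod_eq_zero_iff]
      by_contra hcon
      push Not at hcon
      apply hy
      rw [sum_JJ x hM]
      refine Finset.sum_nonpos fun i hi => ?_
      have := hcon i hi
      refine good_sum ?_
      by_contra hg
      exact this (by simp [gi, hg])
  · have h0 : ∀ i, M i = [] := by
      intro i
      by_contra h
      exact hs ⟨i, by simpa [supp] using h⟩
    have : {T | GSL M T} = {[]} := by
      ext T
      simp only [Set.mem_setOf_eq, Set.mem_singleton_iff]
      constructor
      · intro hT
        cases T with
        | nil => rfl
        | cons C T =>
          obtain ⟨A, ⟨i, hi⟩, hA', -⟩ := hT.uncons hM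
          exact absurd (h0 i) (hA' i hi)
      · rintro rfl
        refine ⟨by simp, by simp, ?_, ?_, ?_⟩
        · ext a
          simp [mem_JJ, h0, lUnion]
        · intro i; simp [h0]
        · intro i; simp [h0]
    unfold FF
    rw [this, finsum_mem_singleton]
    simp [h0, gi, good, tot]

/-! Transfer to the statement. -/

theorem lUnion_append {n : ℕ} (L L' : List (Finset (Fin n))) :
    lUnion (L ++ L') = lUnion L ∪ lUnion L' := by
  ext a; simp [mem_lUnion, or_and_right, exists_or]

theorem good_iff {n : ℕ} (x : Fin n → ℝ) (T : List (Finset (Fin n))) :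
    good x T ↔ ∀ i, ∑ j ∈ lUnion (T.drop i), x j ≤ 0 := by
  induction T with
  | nil => simp [good, lUnion]
  | cons B T ih =>
    simp only [good, ih]
    constructor
    · rintro ⟨h1, h2⟩ i
      cases i with
      | zero => exact h1
      | succ i => exact h2 i
    · intro h
      exact ⟨h 0, fun i => h (i + 1)⟩

theorem split_sum {n : ℕ} (x : Fin n → ℝ) {T : List (Finset (Fin n))}
    (hT : T.Pairwise Disjoint) (i : ℕ) :
    ∑ j ∈ lUnion T, x j = ∑ j ∈ lUnion (T.take i), x j + ∑ j ∈ lUnion (T.drop i), x j := by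
  have h : lUnion T = lUnion (T.take i) ∪ lUnion (T.drop i) := by
    rw [← lUnion_append, List.take_append_drop]
  rw [h, Finset.sum_union]
  rw [← List.take_append_drop i T, List.pairwise_append] at hT
  rw [Finset.disjoint_left]
  intro a ha ha'
  rw [mem_lUnion] at ha ha'
  obtain ⟨B, hB, ha⟩ := ha
  obtain ⟨B', hB', ha'⟩ := ha'
  exact Finset.disjoint_left.mp (hT.2.2 B hB B' hB') ha ha'

theorem plate_iff {n : ℕ} (x : Fin n → ℝ) {T : List (Finset (Fin n))}
    (hT : T.Pairwise Disjoint) (h0 : ∑ j ∈ lUnion T, x j = 0) :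
    (∀ i : ℕ, 0 < i → i < T.length → 0 ≤ ∑ j ∈ lUnion (T.take i), x j) ↔ good x T := by
  rw [good_iff]
  constructor
  · intro h i
    have hs := split_sum x hT i
    rcases Nat.eq_zero_or_pos i with rfl | hi
    · simp [h0]
    · by_cases hl : i < T.length
      · have := h i hi hl
        linarith
      · rw [List.drop_eq_nil_of_le (by omega)]
        simp [lUnion]
  · intro h i _ _
    have hs := split_sum x hT i
    have := h i
    linarith

theorem good_congr {n : ℕ} {x y : Fin n → ℝ} {T : List (Finset (Fin n))}
    (h : ∀ j ∈ lUnion T, x j = y j) : good x T ↔ good y T := by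
  rw [good_iff, good_iff]
  refine forall_congr' fun i => ?_
  rw [Finset.sum_congr rfl]
  intro j hj
  apply h
  rw [mem_lUnion] at hj ⊢
  obtain ⟨B, hB, hj⟩ := hj
  exact ⟨B, List.mem_of_mem_drop hB, hj⟩

theorem mink {n : ℕ} {ι : Type} [Fintype ι] (x : Fin n → ℝ)
    {M : ι → List (Finset (Fin n))} (hM : Valid M) (hJ : JJ M = Finset.univ)
    (hx : ∑ i, x i = 0) : x ∈ ∑ i, plate (M i) ↔ ∀ i, good x (M i) := by
  rw [Set.mem_finset_sum]
  constructor
  · rintro ⟨g, hg, hs⟩ i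
    have hgi := hg (Finset.mem_univ i)
    rw [good_congr (y := g i)]
    · exact (plate_iff _ (hM.pd i) hgi.2.2.1).1 hgi.2.2.2
    · intro j hj
      rw [← hs, Finset.sum_apply]
      refine Finset.sum_eq_single i ?_ (by simp)
      intro k _ hk
      exact (hg (Finset.mem_univ k)).2.1 j
        fun hj' => Finset.disjoint_left.mp (hM.cd k i hk) hj' hj
  · intro h
    have hz : ∀ i, ∑ j ∈ lUnion (M i), x j = 0 := by
      have := sum_JJ x hM
      rw [hJ, hx] at this
      have h2 := (Finset.sum_eq_zero_iff_of_nonpos (fun i _ => good_sum (h i))).1 this.symm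
      exact fun i => h2 i (Finset.mem_univ i)
    refine ⟨fun i j => if j ∈ lUnion (M i) then x j else 0, ?_, ?_⟩
    · intro i _
      have hz' : ∑ j ∈ lUnion (M i), (if j ∈ lUnion (M i) then x j else 0) = 0 := by
        rw [← hz i]
        exact Finset.sum_congr rfl fun j hj => if_pos hj
      refine ⟨?_, ?_, hz', ?_⟩
      · refine Eq.trans ?_ (hz i)
        simp
      · intro j hj
        simp [hj]
      · rw [plate_iff _ (hM.pd i) hz', good_congr (y := x)]
        · exact h i
        · intro j hj
          simp [hj]
    · ext j
      rw [Finset.sum_apply]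
      have : j ∈ JJ M := by rw [hJ]; simp
      simp only [JJ, Finset.mem_biUnion, Finset.mem_univ, true_and] at this
      obtain ⟨i, hi⟩ := this
      rw [Finset.sum_eq_single i]
      · simp [hi]
      · intro k _ hk
        exact if_neg fun hj' => Finset.disjoint_left.mp (hM.cd k i hk) hj' hi
      · simp

theorem SL_iff {n : ℕ} (Ls : List (List (Finset (Fin n))))
    (hJ : JJ (fun i : Fin Ls.length => Ls[i]) = Finset.univ) (T : List (Finset (Fin n))) :
    IsShuffleLumping Ls T ↔ GSL (fun i : Fin Ls.length => Ls[i]) T := by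
  have hb : ∀ B : Finset (Fin n), (∃ j < T.length, B ⊆ T.getD j ∅) ↔ ∃ C ∈ T, B ⊆ C := by
    intro B
    constructor
    · rintro ⟨j, hj, h⟩
      refine ⟨T[j], by simp, ?_⟩
      rwa [List.getD_eq_getElem _ _ hj] at h
    · rintro ⟨C, hC, h⟩
      obtain ⟨j, hj, rfl⟩ := List.mem_iff_getElem.1 hC
      exact ⟨j, hj, by rwa [List.getD_eq_getElem _ _ hj]⟩
  have hp : ∀ L : List (Finset (Fin n)), (∀ p q : ℕ, p < q → q < L.length →
      subIdx T (L.getD p ∅) < subIdx T (L.getD q ∅)) ↔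
      L.Pairwise fun B B' => subIdx T B < subIdx T B' := by
    intro L
    rw [List.pairwise_iff_getElem]
    constructor
    · intro h p q hp hq hpq
      have := h p q hpq hq
      rwa [List.getD_eq_getElem _ _ hp, List.getD_eq_getElem _ _ hq] at this
    · intro h p q hpq hq
      rw [List.getD_eq_getElem _ _ (hpq.trans hq), List.getD_eq_getElem _ _ hq]
      exact h p q _ _ hpq
  unfold IsShuffleLumping IsOSP
  simp only [hb, hp]
  constructor
  · rintro ⟨⟨a, b, c⟩, d, e⟩
    exact ⟨a, b, by rw [hJ, c], fun i => d _ (List.getElem_mem _),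
      fun i => e _ (List.getElem_mem _)⟩
  · rintro ⟨a, b, c, d, e⟩
    refine ⟨⟨a, b, by rw [c, hJ]⟩, ?_, ?_⟩
    · intro L hL
      obtain ⟨j, hj, rfl⟩ := List.mem_iff_getElem.1 hL
      exact d ⟨j, hj⟩
    · intro L hL
      obtain ⟨j, hj, rfl⟩ := List.mem_iff_getElem.1 hL
      exact e ⟨j, hj⟩

/-- Let `S₁,…,S_l` be ordered set partitions of pairwise disjoint
nonempty subsets of `{1,…,n}` whose union is `{1,…,n}`, with `m` blocks in total.
Then the indicator function of the Minkowski sum of their plates equals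
`∑_T (−1)^{m − len(T)} [[T]]`, the sum being over all shuffle-lumpings `T` of
`S₁,…,S_l`. -/
theorem statement_6 (n : ℕ) (Ls : List (List (Finset (Fin n))))
    (h1 : ∀ M ∈ Ls, IsOSP (lUnion M) M)
    (h2 : ∀ M ∈ Ls, M ≠ [])
    (h3 : (Ls.map lUnion).Pairwise Disjoint)
    (h4 : lUnion (Ls.map lUnion) = Finset.univ)
    (x : Fin n → ℝ) (hx : ∑ i, x i = 0) :
    ind ((Ls.map plate).sum) x =
    ∑ᶠ T ∈ {T : List (Finset (Fin n)) | IsShuffleLumping Ls T},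
      (-1 : ℚ) ^ ((Ls.map List.length).sum - T.length) * ind (plate T) x := by
  have hM : Valid (fun i : Fin Ls.length => Ls[i]) := by
    refine ⟨fun i => (h1 _ (List.getElem_mem _)).1, fun i => (h1 _ (List.getElem_mem _)).2.1, ?_⟩
    rw [List.pairwise_map, List.pairwise_iff_getElem] at h3
    intro i j hij
    rcases lt_or_gt_of_ne hij with h | h
    · exact h3 i j i.2 j.2 h
    · exact (h3 j i j.2 i.2 h).symm
  have hJ : JJ (fun i : Fin Ls.length => Ls[i]) = Finset.univ := by
    rw [← h4]
    ext a
    rw [mem_lUnion]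
    simp only [JJ, Finset.mem_biUnion, Finset.mem_univ, true_and, List.mem_map,
      exists_exists_and_eq_and]
    constructor
    · rintro ⟨i, hi⟩
      exact ⟨_, List.getElem_mem _, hi⟩
    · rintro ⟨L, hL, ha⟩
      obtain ⟨j, hj, rfl⟩ := List.mem_iff_getElem.1 hL
      exact ⟨⟨j, hj⟩, ha⟩
  have hsum : (Ls.map plate).sum = ∑ i : Fin Ls.length, plate Ls[i] := by
    rw [← Fin.sum_univ_fun_getElem]; rfl
  have htot : (Ls.map List.length).sum = tot (fun i : Fin Ls.length => Ls[i]) := by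
    rw [← Fin.sum_univ_fun_getElem]; rfl
  have hF := FF_eq x _ _ hM rfl
  have hL : ind ((Ls.map plate).sum) x = ∏ i : Fin Ls.length, gi x Ls[i] := by
    unfold ind
    rw [hsum]
    have := mink x hM hJ hx
    rw [if_congr this rfl rfl]
    unfold gi
    rw [Finset.prod_ite_zero]
    simp
  rw [hL]
  refine hF.symm.trans ?_
  unfold FF
  refine finsum_mem_congr ?_ ?_
  · ext T
    exact (SL_iff Ls hJ T).symm
  · intro T hT
    have hT' : GSL _ T := (SL_iff Ls hJ T).1 hT
    have hlen := GSL_len T hM hT'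
    rw [htot]
    have hu : lUnion T = Finset.univ := by rw [hT'.un, hJ]
    have h0 : ∑ j ∈ lUnion T, x j = 0 := by rw [hu, hx]
    have hpl : x ∈ plate T ↔ good x T := by
      rw [← plate_iff x hT'.pd h0]
      constructor
      · exact fun h => h.2.2.2
      · exact fun h => ⟨hx, fun j hj => absurd (by rw [hu]; simp) hj, h0, h⟩
    congr 1
    · obtain ⟨k, hk⟩ := Nat.exists_eq_add_of_le hlen
      rw [hk, Nat.add_sub_cancel_left, show T.length + k + T.length = 2 * T.length + k by ring,
        pow_add, pow_mul]
      simp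
    · unfold gi ind
      rw [if_congr hpl rfl rfl]

end PlatesPaper
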